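/- Let N ≥ 2, let G be a connected simple graph on the vertex set Fin N, and let W assign to each edge e of G a weight W_e > 0 with ∑_e W_e = 1. For an edge e = {i, j}, let P_e = I − (1/2)(e_i − e_j)(e_i − e_j)ᵀ ∈ Matrix (Fin N) (Fin N) ℝ, where e_i is the i-th standard basis vector. Let y₀ ∈ ℝ^N satisfy ∑_i (y₀)_i = 0, and define the matrix sequence Σ̄ : ℕ → Matrix (Fin N) (Fin N) ℝ by Σ̄(0) = y₀y₀ᵀ and Σ̄(t+1) = ∑_e W_e · P_e Σ̄(t) P_e + (1/4)(I − ∑_e W_e · P_e). Then lim_{t→∞} Σ̄(t) = (1/4)(I − (1/N)·J), where J is the N×N all-ones matrix. -/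

import Mathlib

open Matrix MeasureTheory

/-- The gossip averaging matrix `P = I − (1/2)(eᵢ − eⱼ)(eᵢ − eⱼ)ᵀ`. -/
noncomputable def gossipP (N : ℕ) (i j : Fin N) : Matrix (Fin N) (Fin N) ℝ :=
  1 - ((1:ℝ)/2) • vecMulVec (Pi.single i 1 - Pi.single j 1) (Pi.single i 1 - Pi.single j 1)

lemma gossipP_symmArgs (N : ℕ) (i j : Fin N) : gossipP N i j = gossipP N j i := by
  unfold gossipP
  congr 1
  ext a b
  simp [vecMulVec_apply]
  ring

/-- The gossip averaging matrix associated with an unordered edge. -/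
noncomputable def gossipPSym (N : ℕ) : Sym2 (Fin N) → Matrix (Fin N) (Fin N) ℝ :=
  Sym2.lift ⟨gossipP N, gossipP_symmArgs N⟩

/-- A gossip step on `{i, j}` dissipates exactly `(vᵢ - vⱼ)² / 2` of the squared norm. -/
lemma sum_sq_gossipP_mulVec (N : ℕ) (i j : Fin N) (v : Fin N → ℝ) :
    ∑ a, (gossipP N i j *ᵥ v) a ^ 2 = ∑ a, v a ^ 2 - (v i - v j) ^ 2 / 2 := by
  rcases eq_or_ne i j with rfl | hij
  · simp [gossipP]
  · have hentry : ∀ a, (gossipP N i j *ᵥ v) a ^ 2 = v a ^ 2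
        - (v i - v j) * ((Pi.single i 1 - Pi.single j 1 : Fin N → ℝ) a * v a)
        + (v i - v j) ^ 2 / 4 * (Pi.single i 1 + Pi.single j 1 : Fin N → ℝ) a := by
      intro a
      have hsq : (Pi.single i 1 - Pi.single j 1 : Fin N → ℝ) a ^ 2
          = (Pi.single i 1 + Pi.single j 1 : Fin N → ℝ) a := by
        rcases eq_or_ne a i with rfl | hai
        · simp [hij]
        · rcases eq_or_ne a j with rfl | haj <;> simp [*]
      have hmul : (gossipP N i j *ᵥ v) a
          = v a - (v i - v j) / 2 * (Pi.single i 1 - Pi.single j 1 : Fin N → ℝ) a := by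
        simp only [gossipP, sub_mulVec, one_mulVec, smul_mulVec, vecMulVec_mulVec,
          sub_dotProduct, single_one_dotProduct, Pi.sub_apply, Pi.smul_apply, smul_eq_mul,
          MulOpposite.smul_eq_mul_unop, MulOpposite.unop_op]
        ring
      rw [hmul, ← hsq]
      ring
    have hdiff : ∑ a, (Pi.single i 1 - Pi.single j 1 : Fin N → ℝ) a * v a = v i - v j := by
      simp [sub_mul, Finset.sum_sub_distrib, Pi.single_apply]
    have htwo : ∑ a, (Pi.single i 1 + Pi.single j 1 : Fin N → ℝ) a = 2 := by
      simp [Finset.sum_add_distrib]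
      norm_num
    simp only [hentry, Finset.sum_add_distrib, Finset.sum_sub_distrib, ← Finset.mul_sum,
      hdiff, htwo]
    ring

lemma gossipP_transpose (N : ℕ) (i j : Fin N) : (gossipP N i j)ᵀ = gossipP N i j := by
  simp [gossipP, transpose_vecMulVec]

lemma gossipP_mul_self (N : ℕ) (i j : Fin N) :
    gossipP N i j * gossipP N i j = gossipP N i j := by
  rcases eq_or_ne i j with rfl | hij
  · simp [gossipP]
  · have hdot : (Pi.single i 1 - Pi.single j 1 : Fin N → ℝ) ⬝ᵥ
        (Pi.single i 1 - Pi.single j 1) = 2 := by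
      simp [hij, hij.symm]
      norm_num
    simp only [gossipP, sub_mul, mul_sub, one_mul, mul_one, smul_mul_smul_comm,
      vecMulVec_mul_vecMulVec, hdot]
    ext a b
    simp [vecMulVec_apply]
    ring

lemma one_vecMul_gossipP (N : ℕ) (i j : Fin N) : 1 ᵥ* gossipP N i j = 1 := by
  have hdot : (1 : Fin N → ℝ) ⬝ᵥ (Pi.single i 1 - Pi.single j 1) = 0 := by simp
  simp [gossipP, vecMul_sub, vecMul_smul, vecMul_vecMulVec, hdot]

lemma gossipPSym_transpose (N : ℕ) (e : Sym2 (Fin N)) :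
    (gossipPSym N e)ᵀ = gossipPSym N e :=
  e.ind fun i j => gossipP_transpose N i j

lemma gossipPSym_mul_self (N : ℕ) (e : Sym2 (Fin N)) :
    gossipPSym N e * gossipPSym N e = gossipPSym N e :=
  e.ind fun i j => gossipP_mul_self N i j

lemma one_vecMul_gossipPSym (N : ℕ) (e : Sym2 (Fin N)) : 1 ᵥ* gossipPSym N e = 1 :=
  e.ind fun i j => one_vecMul_gossipP N i j

lemma gossipPSym_mulVec_one (N : ℕ) (e : Sym2 (Fin N)) : gossipPSym N e *ᵥ 1 = 1 := by
  rw [← gossipPSym_transpose, mulVec_transpose, one_vecMul_gossipPSym]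

/-- The squared Frobenius norm of a real matrix. -/
def frobSq {N : ℕ} (M : Matrix (Fin N) (Fin N) ℝ) : ℝ := ∑ b, ∑ a, M a b ^ 2

lemma frobSq_nonneg {N : ℕ} (M : Matrix (Fin N) (Fin N) ℝ) : 0 ≤ frobSq M :=
  Finset.sum_nonneg fun _ _ => Finset.sum_nonneg fun _ _ => sq_nonneg _

lemma frobSq_transpose {N : ℕ} (M : Matrix (Fin N) (Fin N) ℝ) : frobSq Mᵀ = frobSq M :=
  Finset.sum_comm

lemma frobSq_gossipP_mul {N : ℕ} (i j : Fin N) (M : Matrix (Fin N) (Fin N) ℝ) :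
    frobSq (gossipP N i j * M) = frobSq M - ∑ k, (M i k - M j k) ^ 2 / 2 := by
  rw [frobSq, frobSq, ← Finset.sum_sub_distrib]
  exact Finset.sum_congr rfl fun k _ => sum_sq_gossipP_mulVec N i j fun a => M a k

lemma frobSq_gossipP_conj_le {N : ℕ} (i j k : Fin N) (M : Matrix (Fin N) (Fin N) ℝ) :
    frobSq (gossipP N i j * M * gossipP N i j) ≤ frobSq M - (M i k - M j k) ^ 2 / 2 := by
  have hright : frobSq (gossipP N i j * M * gossipP N i j) ≤ frobSq (gossipP N i j * M) := by
    rw [← frobSq_transpose, transpose_mul, gossipP_transpose, frobSq_gossipP_mul,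
      frobSq_transpose]
    exact sub_le_self _ (Finset.sum_nonneg fun _ _ => by positivity)
  have hterm : (M i k - M j k) ^ 2 / 2 ≤ ∑ k, (M i k - M j k) ^ 2 / 2 :=
    Finset.single_le_sum (f := fun k => (M i k - M j k) ^ 2 / 2)
      (fun _ _ => by positivity) (Finset.mem_univ k)
  rw [frobSq_gossipP_mul] at hright
  linarith

lemma frobSq_gossipPSym_conj_le {N : ℕ} (e : Sym2 (Fin N)) (M : Matrix (Fin N) (Fin N) ℝ) :
    frobSq (gossipPSym N e * M * gossipPSym N e) ≤ frobSq M := by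
  induction e using Sym2.ind with
  | _ i j =>
    have := frobSq_gossipP_conj_le i j i M
    exact this.trans (sub_le_self _ (by positivity))

lemma frobSq_sum_smul_le {N : ℕ} {ι : Type*} (s : Finset ι) (W : ι → ℝ)
    (hW : ∀ e ∈ s, 0 ≤ W e) (hsum : ∑ e ∈ s, W e = 1)
    (M : ι → Matrix (Fin N) (Fin N) ℝ) :
    frobSq (∑ e ∈ s, W e • M e) ≤ ∑ e ∈ s, W e * frobSq (M e) := by
  simp only [frobSq, Finset.mul_sum]
  rw [Finset.sum_comm (s := s)]
  refine Finset.sum_le_sum fun b _ => ?_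
  rw [Finset.sum_comm (s := s)]
  refine Finset.sum_le_sum fun a _ => ?_
  simpa [Matrix.sum_apply] using
    Real.pow_arith_mean_le_arith_mean_pow_of_even s W (fun e => M e a b) hW hsum even_two

/-- The energy lost in one averaged gossip step controls the differences along each edge. -/
lemma frobSq_gossip_step_le {N : ℕ} {s : Finset (Sym2 (Fin N))} {W : Sym2 (Fin N) → ℝ}
    (hW : ∀ e ∈ s, 0 < W e) (hsum : ∑ e ∈ s, W e = 1) {i j : Fin N} (hij : s(i, j) ∈ s)
    (k : Fin N) (M : Matrix (Fin N) (Fin N) ℝ) :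
    frobSq (∑ e ∈ s, W e • (gossipPSym N e * M * gossipPSym N e))
      ≤ frobSq M - W s(i, j) * ((M i k - M j k) ^ 2 / 2) := by
  refine (frobSq_sum_smul_le s W (fun e he => (hW e he).le) hsum _).trans ?_
  have hrest : ∑ e ∈ s.erase s(i, j), W e * frobSq (gossipPSym N e * M * gossipPSym N e)
      ≤ ∑ e ∈ s.erase s(i, j), W e * frobSq M :=
    Finset.sum_le_sum fun e he => mul_le_mul_of_nonneg_left (frobSq_gossipPSym_conj_le e M)
      (hW e (Finset.mem_of_mem_erase he)).le
  have hedge : W s(i, j) * frobSq (gossipPSym N s(i, j) * M * gossipPSym N s(i, j))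
      ≤ W s(i, j) * (frobSq M - (M i k - M j k) ^ 2 / 2) :=
    mul_le_mul_of_nonneg_left (frobSq_gossipP_conj_le i j k M) (hW _ hij).le
  have htotal : ∑ e ∈ s, W e * frobSq M = frobSq M := by
    rw [← Finset.sum_mul, hsum, one_mul]
  rw [← Finset.add_sum_erase s _ hij] at htotal ⊢
  linarith

/-- Averaged gossip conjugation on a connected graph drives every matrix with vanishing column
sums to zero. -/
lemma tendsto_zero_of_gossip_recursion {N : ℕ} (G : SimpleGraph (Fin N)) [DecidableRel G.Adj]
    (hG : G.Connected) (W : Sym2 (Fin N) → ℝ) (hW : ∀ e ∈ G.edgeFinset, 0 < W e)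
    (hsum : ∑ e ∈ G.edgeFinset, W e = 1) (D : ℕ → Matrix (Fin N) (Fin N) ℝ)
    (hinit : 1 ᵥ* D 0 = 0)
    (hrec : ∀ t, D (t + 1) =
      ∑ e ∈ G.edgeFinset, W e • (gossipPSym N e * D t * gossipPSym N e)) :
    Filter.Tendsto D Filter.atTop (nhds 0) := by
  have hcol : ∀ t, 1 ᵥ* D t = 0 := by
    intro t
    induction t with
    | zero => exact hinit
    | succ t ih =>
      rw [hrec, vecMul_sum]
      refine Finset.sum_eq_zero fun e _ => ?_
      rw [vecMul_smul, ← vecMul_vecMul, ← vecMul_vecMul, one_vecMul_gossipPSym, ih, zero_vecMul,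
        smul_zero]
  have hanti : Antitone fun t => frobSq (D t) := by
    refine antitone_nat_of_succ_le fun t => ?_
    rw [hrec]
    refine (frobSq_sum_smul_le _ W (fun e he => (hW e he).le) hsum _).trans ?_
    calc _ ≤ ∑ e ∈ G.edgeFinset, W e * frobSq (D t) :=
          Finset.sum_le_sum fun e he =>
            mul_le_mul_of_nonneg_left (frobSq_gossipPSym_conj_le e _) (hW e he).le
      _ = frobSq (D t) := by rw [← Finset.sum_mul, hsum, one_mul]
  have hlim := tendsto_atTop_ciInf hanti ⟨0, by rintro _ ⟨t, rfl⟩; exact frobSq_nonneg _⟩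
  have hdrop := hlim.sub (hlim.comp (Filter.tendsto_add_atTop_nat 1))
  rw [sub_self] at hdrop
  have hadj : ∀ i j k, G.Adj i j →
      Filter.Tendsto (fun t => D t i k - D t j k) Filter.atTop (nhds 0) := by
    intro i j k hij
    have hmem : s(i, j) ∈ G.edgeFinset := by simpa using hij
    have hpos := hW _ hmem
    have hsq : Filter.Tendsto (fun t => (D t i k - D t j k) ^ 2) Filter.atTop (nhds 0) := by
      refine squeeze_zero (fun t => sq_nonneg _) (fun t => ?_)
        (by simpa only [mul_zero] using hdrop.const_mul (2 / W s(i, j)))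
      have hstep := frobSq_gossip_step_le hW hsum hmem k (D t)
      rw [← hrec] at hstep
      change _ ≤ 2 / W s(i, j) * (frobSq (D t) - frobSq (D (t + 1)))
      rw [div_mul_eq_mul_div, le_div_iff₀ hpos]
      linarith
    refine (tendsto_zero_iff_abs_tendsto_zero _).2 ?_
    simpa [Function.comp_def, Real.sqrt_sq_eq_abs] using hsq.sqrt
  have hall : ∀ i j k, Filter.Tendsto (fun t => D t i k - D t j k) Filter.atTop (nhds 0) := by
    intro i j k
    obtain ⟨p⟩ := hG.preconnected i j
    induction p with
    | nil => simp
    | cons h _ ih => simpa using (hadj _ _ k h).add ih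
  refine tendsto_pi_nhds.2 fun i => tendsto_pi_nhds.2 fun k => ?_
  have hN : (N : ℝ) ≠ 0 := Nat.cast_ne_zero.2 (Fin.pos i).ne'
  have havg : ∀ t, D t i k = (N : ℝ)⁻¹ * ∑ j, (D t i k - D t j k) := by
    intro t
    have hk : ∑ j, D t j k = 0 := by simpa [vecMul, dotProduct] using congrFun (hcol t) k
    simp [Finset.sum_sub_distrib, hk, hN]
  refine Filter.Tendsto.congr (fun t => (havg t).symm) ?_
  simpa using (tendsto_finsetSum Finset.univ fun j _ => hall i j k).const_mul (N : ℝ)⁻¹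

lemma gossipPSym_conj_centering (N : ℕ) (c : ℝ) (e : Sym2 (Fin N)) :
    gossipPSym N e * (1 - c • Matrix.of (fun _ _ => (1 : ℝ))) * gossipPSym N e
      = gossipPSym N e - c • Matrix.of (fun _ _ => (1 : ℝ)) := by
  have hJ : (Matrix.of fun _ _ => (1 : ℝ) : Matrix (Fin N) (Fin N) ℝ) = vecMulVec 1 1 := by
    ext; simp [vecMulVec_apply]
  simp only [hJ, mul_sub, sub_mul, mul_one, gossipPSym_mul_self, Matrix.mul_smul,
    Matrix.smul_mul, mul_vecMulVec, vecMulVec_mul, gossipPSym_mulVec_one, one_vecMul_gossipPSym]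

/-- Auxiliary second-moment recursion of the compensating gossip algorithm with
probabilistic quantization:
`Σ̄(t+1) = ∑ₑ Wₑ·PₑΣ̄(t)Pₑ + (1/4)(I − ∑ₑ Wₑ·Pₑ)` converges to `(1/4)(I − (1/N)J)`. -/
theorem stmt_11 {N : ℕ} (hN : 2 ≤ N) (G : SimpleGraph (Fin N)) [DecidableRel G.Adj]
    (hG : G.Connected)
    (W : Sym2 (Fin N) → ℝ) (hW : ∀ e ∈ G.edgeFinset, 0 < W e)
    (hsum : ∑ e ∈ G.edgeFinset, W e = 1)
    (y0 : Fin N → ℝ) (hy0 : ∑ i, y0 i = 0)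
    (Sbar : ℕ → Matrix (Fin N) (Fin N) ℝ)
    (hinit : Sbar 0 = vecMulVec y0 y0)
    (hrec : ∀ t, Sbar (t+1) =
      ∑ e ∈ G.edgeFinset, W e • (gossipPSym N e * Sbar t * gossipPSym N e) +
        ((1:ℝ)/4) • (1 - ∑ e ∈ G.edgeFinset, W e • gossipPSym N e)) :
    Filter.Tendsto Sbar Filter.atTop
      (nhds (((1:ℝ)/4) • ((1 : Matrix (Fin N) (Fin N) ℝ)
        - (N : ℝ)⁻¹ • Matrix.of (fun _ _ => (1:ℝ))))) := by
  set L : Matrix (Fin N) (Fin N) ℝ :=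
    ((1:ℝ)/4) • ((1 : Matrix (Fin N) (Fin N) ℝ) - (N : ℝ)⁻¹ • Matrix.of (fun _ _ => (1:ℝ))) with hL
  have hNR : (N : ℝ) ≠ 0 := by positivity
  have hfix : ∑ e ∈ G.edgeFinset, W e • (gossipPSym N e * L * gossipPSym N e) =
      L - ((1:ℝ)/4) • (1 - ∑ e ∈ G.edgeFinset, W e • gossipPSym N e) := by
    simp only [hL, Matrix.mul_smul, Matrix.smul_mul, gossipPSym_conj_centering]
    simp only [smul_comm (_ : ℝ) ((1:ℝ)/4), ← Finset.smul_sum, smul_sub,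
      Finset.sum_sub_distrib, ← Finset.sum_smul, hsum, one_smul]
    abel
  have hD := tendsto_zero_of_gossip_recursion G hG W hW hsum (fun t => Sbar t - L) ?_ ?_
  · simpa using hD.add_const L
  · ext k
    simp [hinit, hL, vecMul, dotProduct, vecMulVec_apply, ← Finset.sum_mul, hy0, hNR,
      Finset.sum_sub_distrib, ← Finset.mul_sum, Matrix.one_apply]
  · intro t
    simp only [mul_sub, sub_mul, smul_sub, Finset.sum_sub_distrib, hfix, hrec]
    abel
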